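/- arXiv:2411.07673 — 2 statements merged into one kernel-verified Lean document; each statement's English description precedes it below -/
import Mathlib

section
/- Let L be a nonzero nilpotent linear map on ℂ^n of index m ≥ 2. Then there exists an orthonormal basis of ℂ^n in which L is represented by a strictly block upper-triangular matrix A = (A_i^j) with nonzero blocks only in positions (j-1, j) and above, where each superdiagonal block A_{j-1}^j is an r_{j-1} × r_j matrix in upper-triangular echelon form with all diagonal entries (pivots) nonzero, and r_j = dim(ker L^j ∩ (ker L^{j-1})^⊥). -/
open Module Matrix

/-- Position of index `i` within its block (the number of earlier indices in the same
block) for a block-labelling `blk`. -/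
def blockPos {n : ℕ} (blk : Fin n → ℕ) (i : Fin n) : ℕ :=
  (Finset.univ.filter fun i' : Fin n => blk i' = blk i ∧ i' < i).card

section TriangularBases

variable {𝕜 E V W : Type*} [RCLike 𝕜]
  [NormedAddCommGroup E] [InnerProductSpace 𝕜 E]
  [NormedAddCommGroup V] [InnerProductSpace 𝕜 V]
  [NormedAddCommGroup W] [InnerProductSpace 𝕜 W]

lemma inner_gramSchmidt_self_ne_zero {ι : Type*} [LinearOrder ι] [LocallyFiniteOrderBot ι]
    [WellFoundedLT ι] {f : ι → E} {i : ι} (hi : InnerProductSpace.gramSchmidt 𝕜 f i ≠ 0) :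
    inner 𝕜 (InnerProductSpace.gramSchmidt 𝕜 f i) (f i) ≠ 0 := by
  have hsum : inner 𝕜 (InnerProductSpace.gramSchmidt 𝕜 f i) (f i) =
      inner 𝕜 (InnerProductSpace.gramSchmidt 𝕜 f i) (InnerProductSpace.gramSchmidt 𝕜 f i) := by
    conv_lhs => rw [InnerProductSpace.gramSchmidt_def'' 𝕜 f i]
    rw [inner_add_right, inner_sum, Finset.sum_eq_zero, add_zero]
    intro k hk
    rw [inner_smul_right, InnerProductSpace.gramSchmidt_orthogonal 𝕜 f (Finset.mem_Iio.1 hk).ne',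
      mul_zero]
  rw [hsum]
  exact inner_self_ne_zero.2 hi

/-- The images of a basis under an injective linear map are in echelon form with respect to a
suitable orthonormal basis of the target. -/
lemma LinearMap.exists_orthonormalBasis_echelon [FiniteDimensional 𝕜 W] {r : ℕ}
    (e : OrthonormalBasis (Fin r) 𝕜 V) (T : V →ₗ[𝕜] W) (hT : Function.Injective T) :
    ∃ b : OrthonormalBasis (Fin (finrank 𝕜 W)) 𝕜 W, ∀ (i : Fin (finrank 𝕜 W)) (j : Fin r),
      ((j : ℕ) < i → inner 𝕜 (b i) (T (e j)) = 0) ∧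
      ((j : ℕ) = i → inner 𝕜 (b i) (T (e j)) ≠ 0) := by
  let f : Fin (finrank 𝕜 W) → W := fun i => if h : (i : ℕ) < r then T (e ⟨i, h⟩) else 0
  have hcard : finrank 𝕜 W = Fintype.card (Fin (finrank 𝕜 W)) := by simp
  have hf : ∀ (i : Fin (finrank 𝕜 W)) (j : Fin r), (j : ℕ) = i → f i = T (e j) := by
    intro i j hij
    have hi : (i : ℕ) < r := hij ▸ j.2
    have : (⟨i, hi⟩ : Fin r) = j := Fin.ext hij.symm
    simp [f, hi, this]
  refine ⟨InnerProductSpace.gramSchmidtOrthonormalBasis hcard f, fun i j => ⟨fun hji => ?_,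
    fun hji => ?_⟩⟩
  · have hj : (j : ℕ) < finrank 𝕜 W := hji.trans i.2
    rw [← hf ⟨j, hj⟩ j rfl]
    exact InnerProductSpace.gramSchmidtOrthonormalBasis_inv_triangular hcard f hji
  · have hlt : ∀ k : Set.Iic i, ((k : Fin (finrank 𝕜 W)) : ℕ) < r := fun k =>
      lt_of_le_of_lt (Fin.le_def.1 k.2) (hji.symm.trans_lt j.2)
    have hind : LinearIndependent 𝕜 (f ∘ ((↑) : Set.Iic i → Fin (finrank 𝕜 W))) := by
      have h := (e.orthonormal.linearIndependent.map' T (LinearMap.ker_eq_bot.2 hT)).comp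
        (fun k : Set.Iic i => (⟨k, hlt k⟩ : Fin r))
        (fun k l hkl => Subtype.ext (Fin.ext (Fin.mk.inj hkl)))
      convert! h using 1
      ext1 k
      exact hf _ _ rfl
    have hne := InnerProductSpace.gramSchmidt_ne_zero_coe (𝕜 := 𝕜) i hind
    have hne' : InnerProductSpace.gramSchmidtNormed 𝕜 f i ≠ 0 := by
      simpa [InnerProductSpace.gramSchmidtNormed] using hne
    rw [InnerProductSpace.gramSchmidtOrthonormalBasis_apply hcard hne', ← hf i j hji,
      InnerProductSpace.gramSchmidtNormed, inner_smul_left]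
    exact mul_ne_zero (by simpa using hne) (inner_gramSchmidt_self_ne_zero hne)

end TriangularBases

/-- Backward dependent choice up to a finite stage. -/
lemma exists_backward_chain {α : ℕ → Type*} [∀ k, Nonempty (α k)]
    (R : ∀ k, α (k + 1) → α k → Prop) (hR : ∀ k x, ∃ y, R k x y) (m : ℕ) :
    ∃ B : ∀ k, α k, ∀ k < m, R k (B (k + 1)) (B k) := by
  induction m generalizing α with
  | zero => exact ⟨fun k => Classical.arbitrary _, fun k hk => absurd hk k.not_lt_zero⟩
  | succ m ih =>
    obtain ⟨B, hB⟩ := ih (α := fun k => α (k + 1)) (fun k => R (k + 1)) (fun k => hR (k + 1))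
    obtain ⟨y, hy⟩ := hR 0 (B 0)
    refine ⟨fun k => Nat.casesOn k y B, fun k hk => ?_⟩
    cases k with
    | zero => exact hy
    | succ k => exact hB k (Nat.lt_of_succ_lt_succ hk)

/-- Lexicographic enumeration of a finite disjoint union of initial segments. -/
lemma exists_equiv_sigma_fin_lex {n m : ℕ} (r : Fin m → ℕ)
    (h : Fintype.card (Σ i, Fin (r i)) = n) :
    ∃ φ : Fin n ≃ Σ i, Fin (r i), Monotone (fun i => (φ i).1) ∧
      ∀ i, (Finset.univ.filter fun i' => (φ i').1 = (φ i).1 ∧ i' < i).card = (φ i).2 := by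
  let : Fintype (Lex (Σ i, Fin (r i))) := inferInstanceAs (Fintype (Σ i, Fin (r i)))
  let ψ : Fin n ≃o Lex (Σ i, Fin (r i)) := monoEquivOfFin _ h
  let φ : Fin n ≃ Σ i, Fin (r i) := ψ.toEquiv.trans ofLex
  have hlt : ∀ i j, i < j ↔ Sigma.Lex (· < ·) (fun _ => (· < ·)) (φ i) (φ j) := fun i j =>
    (ψ.lt_iff_lt (x := i) (y := j)).symm
  refine ⟨φ, fun i j hij => ?_, fun i => ?_⟩
  · rcases hij.eq_or_lt with rfl | hij
    · rfl
    · rcases Sigma.lex_iff.1 ((hlt i j).1 hij) with h | ⟨h, -⟩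
      exacts [h.le, h.le]
  · have hset : (Finset.univ.filter fun i' => (φ i').1 = (φ i).1 ∧ i' < i) =
        (Finset.Iio (φ i).2).map
          ((Function.Embedding.sigmaMk (φ i).1).trans φ.symm.toEmbedding) := by
      ext i'
      simp only [Finset.mem_filter, Finset.mem_univ, true_and, Finset.mem_map, Finset.mem_Iio,
        Function.Embedding.trans_apply, Function.Embedding.sigmaMk_apply, Equiv.coe_toEmbedding,
        Equiv.symm_apply_eq]
      rw [hlt]
      generalize φ i' = a, φ i = c
      obtain ⟨a₁, a₂⟩ := a
      obtain ⟨c₁, c₂⟩ := c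
      constructor
      · rintro ⟨h, hac⟩
        obtain rfl : a₁ = c₁ := h
        rcases hac with ⟨_, _, h⟩ | ⟨_, _, h⟩
        exacts [absurd h (lt_irrefl _), ⟨_, h, rfl⟩]
      · rintro ⟨x, hx, h⟩
        cases h
        exact ⟨rfl, Sigma.Lex.right _ _ hx⟩
    rw [hset, Finset.card_map, Fin.card_Iio]

section KernelFiltration

variable {𝕜 E : Type*} [RCLike 𝕜] [NormedAddCommGroup E] [InnerProductSpace 𝕜 E]

/-- The orthogonal complement of `ker L ^ k` inside `ker L ^ (k + 1)`. -/
def kerLayer (L : E →ₗ[𝕜] E) (k : ℕ) : Submodule 𝕜 E :=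
  LinearMap.ker (L ^ (k + 1)) ⊓ (LinearMap.ker (L ^ k))ᗮ

lemma ker_pow_mono (L : E →ₗ[𝕜] E) : Monotone fun k => LinearMap.ker (L ^ k) := by
  intro k l hkl x hx
  obtain ⟨d, rfl⟩ := Nat.exists_eq_add_of_le' hkl
  simp only [LinearMap.mem_ker] at hx ⊢
  rw [pow_add, Module.End.mul_apply, hx, map_zero]

lemma orthogonalFamily_kerLayer (L : E →ₗ[𝕜] E) :
    OrthogonalFamily 𝕜 (fun k => kerLayer L k) fun k => (kerLayer L k).subtypeₗᵢ := by
  apply OrthogonalFamily.of_pairwise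
  intro k l hkl
  wlog h : k < l generalizing k l
  · exact (this hkl.symm (lt_of_le_of_ne (not_lt.1 h) hkl.symm)).symm
  · refine Submodule.isOrtho_iff_inner_eq.2 ?_
    intro x hx y hy
    exact Submodule.inner_right_of_mem_orthogonal (ker_pow_mono L (Nat.succ_le_of_lt h) hx.1) hy.2

variable [FiniteDimensional 𝕜 E]

lemma ker_pow_sup_kerLayer (L : E →ₗ[𝕜] E) (k : ℕ) :
    LinearMap.ker (L ^ k) ⊔ kerLayer L k = LinearMap.ker (L ^ (k + 1)) := by
  rw [kerLayer, inf_comm]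
  exact Submodule.sup_orthogonal_inf_of_hasOrthogonalProjection (ker_pow_mono L k.le_succ)

lemma isInternal_kerLayer {L : E →ₗ[𝕜] E} {m : ℕ} (hL : L ^ m = 0) :
    DirectSum.IsInternal fun k : Fin m => kerLayer L k := by
  have hle : ∀ k ≤ m, LinearMap.ker (L ^ k) ≤ ⨆ i : Fin m, kerLayer L i := by
    intro k
    induction k with
    | zero => simp [Module.End.one_eq_id]
    | succ k ih =>
      intro hk
      rw [← ker_pow_sup_kerLayer]
      exact sup_le (ih (Nat.le_of_succ_le hk))
        (le_iSup (fun i : Fin m => kerLayer L i) ⟨k, hk⟩)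
  have htop : (⨆ i : Fin m, kerLayer L i) = ⊤ := by
    have h := hle m le_rfl
    rw [hL, LinearMap.ker_zero] at h
    exact top_le_iff.1 h
  rw [((orthogonalFamily_kerLayer L).comp Fin.val_injective).isInternal_iff]
  exact (congrArg _ htop).trans Submodule.top_orthogonal_eq_bot

/-- The component of `L` from one layer of the kernel filtration to the next lower one. -/
noncomputable def layerMap (L : E →ₗ[𝕜] E) (k : ℕ) : kerLayer L (k + 1) →ₗ[𝕜] kerLayer L k :=
  (kerLayer L k).orthogonalProjectionOnto.toLinearMap ∘ₗ L ∘ₗ (kerLayer L (k + 1)).subtype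

lemma inner_layerMap (L : E →ₗ[𝕜] E) (k : ℕ) (y : kerLayer L k) (x : kerLayer L (k + 1)) :
    inner 𝕜 y (layerMap L k x) = inner 𝕜 (y : E) (L x) :=
  Submodule.inner_orthogonalProjectionOnto_eq_of_mem_left y (L x)

lemma layerMap_injective (L : E →ₗ[𝕜] E) (k : ℕ) : Function.Injective (layerMap L k) := by
  rw [← LinearMap.ker_eq_bot, LinearMap.ker_eq_bot']
  intro x hx
  have hLx : L x ∈ LinearMap.ker (L ^ k) ⊔ kerLayer L k := by
    rw [ker_pow_sup_kerLayer]
    simpa [pow_succ] using x.2.1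
  obtain ⟨y, hy, z, hz, hyz⟩ := Submodule.mem_sup.1 hLx
  have hz0 : z = 0 := by
    have h := inner_layerMap L k ⟨z, hz⟩ x
    rw [hx, inner_zero_right, ← hyz, inner_add_right,
      Submodule.inner_left_of_mem_orthogonal hy hz.2, zero_add] at h
    exact inner_self_eq_zero.1 h.symm
  have hxk : (x : E) ∈ LinearMap.ker (L ^ (k + 1)) := by
    rw [hz0, add_zero] at hyz
    simpa [pow_succ, ← hyz] using hy
  exact Subtype.ext (inner_self_eq_zero.1 (Submodule.inner_right_of_mem_orthogonal hxk x.2.2))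

lemma exists_orthonormalBasis_kerLayer (L : E →ₗ[𝕜] E) (m : ℕ) :
    ∃ B : ∀ k, OrthonormalBasis (Fin (finrank 𝕜 (kerLayer L k))) 𝕜 (kerLayer L k),
      ∀ k < m, ∀ (i : Fin (finrank 𝕜 (kerLayer L k)))
        (j : Fin (finrank 𝕜 (kerLayer L (k + 1)))),
        ((j : ℕ) < i → inner 𝕜 (B k i : E) (L (B (k + 1) j)) = 0) ∧
        ((j : ℕ) = i → inner 𝕜 (B k i : E) (L (B (k + 1) j)) ≠ 0) := by
  have : ∀ k, Nonempty (OrthonormalBasis (Fin (finrank 𝕜 (kerLayer L k))) 𝕜 (kerLayer L k)) :=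
    fun k => ⟨stdOrthonormalBasis 𝕜 _⟩
  refine exists_backward_chain
    (α := fun k => OrthonormalBasis (Fin (finrank 𝕜 (kerLayer L k))) 𝕜 (kerLayer L k))
    (fun k e b => ∀ (i : Fin (finrank 𝕜 (kerLayer L k)))
      (j : Fin (finrank 𝕜 (kerLayer L (k + 1)))),
    ((j : ℕ) < i → inner 𝕜 (b i : E) (L (e j)) = 0) ∧
    ((j : ℕ) = i → inner 𝕜 (b i : E) (L (e j)) ≠ 0)) (fun k e => ?_) m
  simpa only [inner_layerMap] using
    (layerMap L k).exists_orthonormalBasis_echelon e (layerMap_injective L k)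

end KernelFiltration

/-- A nonzero nilpotent map `L` of index `m ≥ 2` on `ℂⁿ` is represented, in
a suitable orthonormal basis grouped into consecutive blocks of sizes
`r_j = dim (ker L^j ⊓ (ker L^{j-1})ᗮ)`, by a strictly block upper-triangular matrix whose
superdiagonal blocks are in upper-triangular echelon form with nonzero diagonal pivots. -/
theorem nilpotent_column_echelon_form
    (n m : ℕ) (hm : 2 ≤ m)
    (L : EuclideanSpace ℂ (Fin n) →ₗ[ℂ] EuclideanSpace ℂ (Fin n))
    (hLm : L ^ m = 0) (hLm' : L ^ (m - 1) ≠ 0) :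
    ∃ (b : OrthonormalBasis (Fin n) ℂ (EuclideanSpace ℂ (Fin n))) (blk : Fin n → ℕ),
      Monotone blk ∧ (∀ i, 1 ≤ blk i ∧ blk i ≤ m) ∧
      (∀ j, 1 ≤ j → j ≤ m →
        (Finset.univ.filter fun i : Fin n => blk i = j).card =
          finrank ℂ (LinearMap.ker (L ^ j) ⊓ (LinearMap.ker (L ^ (j - 1)))ᗮ :
            Submodule ℂ (EuclideanSpace ℂ (Fin n)))) ∧
      (∀ i j : Fin n, blk j ≤ blk i →
        LinearMap.toMatrix b.toBasis b.toBasis L i j = 0) ∧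
      (∀ i j : Fin n, blk j = blk i + 1 →
        (blockPos blk j < blockPos blk i →
          LinearMap.toMatrix b.toBasis b.toBasis L i j = 0) ∧
        (blockPos blk j = blockPos blk i →
          LinearMap.toMatrix b.toBasis b.toBasis L i j ≠ 0)) := by
  obtain ⟨B, hB⟩ := exists_orthonormalBasis_kerLayer L m
  have hort := (orthogonalFamily_kerLayer L).comp (Fin.val_injective (n := m))
  let c := (isInternal_kerLayer hLm).collectedOrthonormalBasis hort (fun k : Fin m => B k)
  have hc : ∀ s, c s = (B s.1 s.2 : EuclideanSpace ℂ (Fin n)) := fun s => by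
    simp [c, DirectSum.IsInternal.collectedOrthonormalBasis]
  have hcard : Fintype.card (Σ k : Fin m, Fin (finrank ℂ (kerLayer L k))) = n := by
    rw [← finrank_eq_card_basis c.toBasis, finrank_euclideanSpace_fin]
  obtain ⟨φ, hφ, hpos⟩ := exists_equiv_sigma_fin_lex _ hcard
  have hblk : ∀ i, blockPos (fun i => ((φ i).1 : ℕ) + 1) i = (φ i).2 := fun i => by
    rw [← hpos i]
    simp [blockPos, Fin.ext_iff]
  have hent : ∀ i j, LinearMap.toMatrix (c.reindex φ.symm).toBasis (c.reindex φ.symm).toBasis L i j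
      = inner ℂ (B (φ i).1 (φ i).2 : EuclideanSpace ℂ (Fin n)) (L (B (φ j).1 (φ j).2)) :=
    fun i j => by
      simp [LinearMap.toMatrix_apply, OrthonormalBasis.repr_apply_apply, hc]
  refine ⟨c.reindex φ.symm, fun i => (φ i).1 + 1, fun i j hij => Nat.succ_le_succ (hφ hij),
    fun i => ⟨Nat.succ_pos _, (φ i).1.2⟩, ?_, fun i j hij => ?_, fun i j hij => ?_⟩
  · intro j hj hjm
    obtain ⟨k, rfl⟩ := Nat.exists_eq_add_of_le' hj
    have hset : (Finset.univ.filter fun i : Fin n => ((φ i).1 : ℕ) + 1 = k + 1) =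
        (Finset.univ : Finset (Fin (finrank ℂ (kerLayer L k)))).map
          ((Function.Embedding.sigmaMk (⟨k, hjm⟩ : Fin m)).trans φ.symm.toEmbedding) := by
      ext i
      simp only [Finset.mem_filter, Finset.mem_univ, true_and, Finset.mem_map,
        Function.Embedding.trans_apply, Function.Embedding.sigmaMk_apply, Equiv.coe_toEmbedding,
        Equiv.symm_apply_eq]
      generalize φ i = a
      obtain ⟨⟨a₁, ha⟩, a₂⟩ := a
      constructor
      · intro h
        obtain rfl : a₁ = k := Nat.succ_injective h
        exact ⟨a₂, rfl⟩
      · rintro ⟨x, h⟩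
        cases h
        rfl
    rw [hset, Finset.card_map, Finset.card_univ, Fintype.card_fin]
    rfl
  · rw [hent]
    have hmem := (B (φ j).1 (φ j).2).2.1
    refine Submodule.inner_left_of_mem_orthogonal ?_ (B (φ i).1 (φ i).2).2.2
    refine ker_pow_mono L (Nat.le_of_succ_le_succ hij) ?_
    simpa [pow_succ] using hmem
  · rw [hblk, hblk, hent]
    replace hij : ((φ j).1 : ℕ) = (φ i).1 + 1 := Nat.succ_injective hij
    generalize φ i = a, φ j = d at hij ⊢
    obtain ⟨⟨a₁, ha⟩, a₂⟩ := a
    obtain ⟨⟨d₁, hd⟩, d₂⟩ := d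
    obtain rfl : d₁ = a₁ + 1 := hij
    exact hB a₁ ha a₂ d₂
end

section
/- Let A be a nonzero block diagonal nilpotent n×n complex matrix with each block in reduced column echelon form (all pivots equal 1). Then there exists an invertible matrix S, block diagonal with the same block decomposition as A, with ‖S^{±1}‖ ≤ C(n)(1 + ‖A‖)^{n!}, such that S^{-1} A S is in Jordan normal form. -/
open Matrix

/-- The (Euclidean) operator norm of a complex matrix. -/
noncomputable def opNorm {ι κ : Type*} [Fintype ι] [Fintype κ] [DecidableEq κ]
    (M : Matrix ι κ ℂ) : ℝ :=
  ‖LinearMap.toContinuousLinearMap (Matrix.toEuclideanLin M)‖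

/-- The set of rows where column `j` of `B` is nonzero. -/
noncomputable def colSupp {k : ℕ} (B : Matrix (Fin k) (Fin k) ℂ) (j : Fin k) : Finset (Fin k) :=
  Finset.univ.filter fun i => B i j ≠ 0

/-- `B` is in column echelon form. -/
def IsColEchelon {k : ℕ} (B : Matrix (Fin k) (Fin k) ℂ) : Prop :=
  ∀ j j' : Fin k, j < j' → (colSupp B j).Nonempty →
    (colSupp B j).max < (colSupp B j').max

/-- `B i j` is a pivot of `B`: the last nonzero coefficient of the (nonzero) column `j`. -/
def IsPivot {k : ℕ} (B : Matrix (Fin k) (Fin k) ℂ) (i j : Fin k) : Prop :=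
  B i j ≠ 0 ∧ ∀ i', i < i' → B i' j = 0

/-- `B` is in reduced column echelon form: echelon with all pivots equal to `1`. -/
def IsReducedColEchelon {k : ℕ} (B : Matrix (Fin k) (Fin k) ℂ) : Prop :=
  IsColEchelon B ∧ ∀ i j, IsPivot B i j → B i j = 1

/-- A matrix indexed by a sigma type is block diagonal for that decomposition. -/
def IsBlockDiag {l : ℕ} {s : Fin l → ℕ}
    (M : Matrix ((i : Fin l) × Fin (s i)) ((i : Fin l) × Fin (s i)) ℂ) : Prop :=
  ∀ x y, x.1 ≠ y.1 → M x y = 0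

/-- The `i`-th diagonal block of a matrix indexed by a sigma type. -/
def diagBlock {l : ℕ} {s : Fin l → ℕ}
    (M : Matrix ((i : Fin l) × Fin (s i)) ((i : Fin l) × Fin (s i)) ℂ) (i : Fin l) :
    Matrix (Fin (s i)) (Fin (s i)) ℂ :=
  fun p q => M ⟨i, p⟩ ⟨i, q⟩

/-- A nilpotent matrix in Jordan normal form: entries `0` or `1`, supported on the
superdiagonal. -/
def IsNilpotentJordan {k : ℕ} (M : Matrix (Fin k) (Fin k) ℂ) : Prop :=
  ∀ p q : Fin k, ((q : ℕ) ≠ (p : ℕ) + 1 → M p q = 0) ∧ (M p q = 0 ∨ M p q = 1)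

/-- A pivot function `r`, defined on the set `D` of nonzero columns of a nilpotent reduced
column echelon matrix. -/
structure IsPivotFun {k : ℕ} (B : Matrix (Fin k) (Fin k) ℂ) (D : Fin k → Prop)
    (r : Fin k → Fin k) : Prop where
  zero_col : ∀ j, ¬ D j → ∀ i, B i j = 0
  pivot_eq_one : ∀ j, D j → B (r j) j = 1
  zero_below : ∀ j, D j → ∀ i, r j < i → B i j = 0
  upward : ∀ j j', j < j' → D j → D j'
  strictMono : ∀ j j', j < j' → D j → r j < r j'
  lt_self : ∀ j, D j → r j < j

theorem IsPivotFun.injOn {k : ℕ} {B : Matrix (Fin k) (Fin k) ℂ} {D : Fin k → Prop}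
    {r : Fin k → Fin k} (h : IsPivotFun B D r) {i j : Fin k} (hi : D i) (hj : D j)
    (hij : r i = r j) : i = j := by
  rcases lt_trichotomy i j with hlt | heq | hlt
  · exact absurd hij (h.strictMono i j hlt hi).ne
  · exact heq
  · exact absurd hij (h.strictMono j i hlt hj).ne'

/-- A nilpotent matrix in reduced column echelon form has a pivot function. -/
theorem IsReducedColEchelon.exists_isPivotFun {k : ℕ} {B : Matrix (Fin k) (Fin k) ℂ}
    (hB : IsReducedColEchelon B) (hnil : IsNilpotent B) :
    ∃ D r, IsPivotFun B D r := by
  classical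
  set D : Fin k → Prop := fun j => (colSupp B j).Nonempty with hD
  set r : Fin k → Fin k := fun j => if h : (colSupp B j).Nonempty then (colSupp B j).max' h else j
    with hr
  have hmax : ∀ j, D j → (colSupp B j).max = (r j : WithBot (Fin k)) := by
    intro j hj
    simp only [hr, dif_pos (show (colSupp B j).Nonempty from hj), Finset.coe_max']
  have hzero : ∀ j, ¬ D j → ∀ i, B i j = 0 := by
    intro j hj i
    by_contra hne
    exact hj ⟨i, by simp [colSupp, hne]⟩
  have hne : ∀ j, D j → B (r j) j ≠ 0 := by
    intro j hj
    have := Finset.mem_of_max (hmax j hj)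
    simpa [colSupp] using this
  have hbelow : ∀ j, D j → ∀ i, r j < i → B i j = 0 := by
    intro j hj i hi
    by_contra hne
    have : i ≤ r j := Finset.le_max_of_eq (by simp [colSupp, hne]) (hmax j hj)
    exact absurd hi (not_lt.mpr this)
  have hone : ∀ j, D j → B (r j) j = 1 := fun j hj => hB.2 _ _ ⟨hne j hj, hbelow j hj⟩
  have hup : ∀ j j', j < j' → D j → D j' := by
    intro j j' hjj hj
    have h := hB.1 j j' hjj hj
    by_contra hj'
    rw [Finset.not_nonempty_iff_eq_empty.mp hj'] at h
    simp at h
  have hmono : ∀ j j', j < j' → D j → r j < r j' := by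
    intro j j' hjj hj
    have h := hB.1 j j' hjj hj
    rw [hmax j hj, hmax j' (hup j j' hjj hj)] at h
    exact_mod_cast h
  have hle : ∀ d : ℕ, ∀ j : Fin k, k ≤ j + d → D j → r j ≤ j := by
    intro d
    induction d with
    | zero => intro j hd; omega
    | succ d ih =>
      intro j hd hj
      by_contra! hlt
      have hlt' : (j : ℕ) < r j := hlt
      have hjj : j < (⟨j + 1, by omega⟩ : Fin k) := Fin.lt_def.mpr (by simp)
      have h1 := ih ⟨j + 1, by omega⟩ (by simp only; omega) (hup _ _ hjj hj)
      have h2 : (r j : ℕ) < r ⟨j + 1, by omega⟩ := hmono _ _ hjj hj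
      have h3 : (r ⟨j + 1, by omega⟩ : ℕ) ≤ j + 1 := h1
      omega
  refine ⟨D, r, hzero, hone, hbelow, hup, hmono, fun j hj => ?_⟩
  refine lt_of_le_of_ne (hle k j (by omega) hj) fun heq => ?_
  have hrow : ∀ m, m < j → B j m = 0 := by
    intro m hm
    by_cases hDm : D m
    · exact hbelow m hDm j (by simpa [heq] using hmono m j hm hDm)
    · exact hzero m hDm j
  have hlow : ∀ i m, m < i → B i m = 0 := by
    intro i m hm
    by_cases hDm : D m
    · exact hbelow m hDm i ((hle k m (by omega) hDm).trans_lt hm)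
    · exact hzero m hDm i
  have hpow : ∀ e : ℕ, (B ^ e) j j = 1 ∧ ∀ i, j < i → (B ^ e) i j = 0 := by
    intro e
    induction e with
    | zero => exact ⟨by simp, fun i hi => by simp [hi.ne']⟩
    | succ e ih =>
      simp only [pow_succ', Matrix.mul_apply]
      refine ⟨?_, fun i hi => Finset.sum_eq_zero fun m _ => ?_⟩
      · rw [Finset.sum_eq_single j]
        · have := hone j hj
          rw [heq] at this
          rw [this, ih.1, one_mul]
        · intro m _ hm
          rcases lt_or_gt_of_ne hm with h | h
          · rw [hrow m h, zero_mul]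
          · rw [ih.2 m h, mul_zero]
        · simp
      · rcases le_or_gt m j with h | h
        · rw [hlow i m (h.trans_lt hi), zero_mul]
        · rw [ih.2 m h, mul_zero]
  obtain ⟨e, he⟩ := hnil
  have := (hpow e).1
  simp [he] at this

open Classical in
/-- The Jordan basis attached to a pivot function: it starts from a standard basis vector outside
the image of `r` and applies `B` along the orbits of `r`. -/
noncomputable def jordanVec {k : ℕ} (B : Matrix (Fin k) (Fin k) ℂ) (D : Fin k → Prop)
    (r : Fin k → Fin k) (i : Fin k) : Fin k → ℂ :=
  if h : ∃ j, D j ∧ r j = i ∧ i < j then B *ᵥ jordanVec B D r h.choose else Pi.single i 1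
termination_by k - i
decreasing_by
  have := h.choose_spec.2.2
  omega

section jordanVec

variable {k : ℕ} {B : Matrix (Fin k) (Fin k) ℂ} {D : Fin k → Prop} {r : Fin k → Fin k}

theorem jordanVec_pivot (h : IsPivotFun B D r) {j : Fin k} (hj : D j) :
    jordanVec B D r (r j) = B *ᵥ jordanVec B D r j := by
  have hex : ∃ j', D j' ∧ r j' = r j ∧ r j < j' := ⟨j, hj, rfl, h.lt_self j hj⟩
  rw [jordanVec, dif_pos hex, h.injOn hex.choose_spec.1 hj hex.choose_spec.2.1]

theorem jordanVec_of_not_mem {i : Fin k} (hi : ∀ j, D j → r j ≠ i) :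
    jordanVec B D r i = Pi.single i 1 := by
  rw [jordanVec, dif_neg]
  rintro ⟨j, hj, hji, -⟩
  exact hi j hj hji

/-- Induction principle along the orbits of a pivot function, from the top. -/
theorem IsPivotFun.induction (h : IsPivotFun B D r) {p : Fin k → Prop}
    (top : ∀ i, (∀ j, D j → r j ≠ i) → p i) (step : ∀ j, D j → p j → p (r j)) (i : Fin k) :
    p i := by
  induction hd : k - (i : ℕ) using Nat.strong_induction_on generalizing i with
  | _ d ih =>
    by_cases hi : ∃ j, D j ∧ r j = i
    · obtain ⟨j, hj, rfl⟩ := hi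
      have := h.lt_self j hj
      exact step j hj (ih _ (by omega) j rfl)
    · push Not at hi
      exact top i hi

theorem jordanVec_triangular (h : IsPivotFun B D r) (i : Fin k) :
    jordanVec B D r i i = 1 ∧ ∀ m, i < m → jordanVec B D r i m = 0 := by
  refine h.induction (p := fun i => jordanVec B D r i i = 1 ∧
    ∀ m, i < m → jordanVec B D r i m = 0) (fun i hi => ?_) (fun j hj ih => ?_) i
  · rw [jordanVec_of_not_mem hi]
    exact ⟨by simp, fun m hm => by simp [hm.ne']⟩
  · have hz : ∀ p m, r j ≤ p → m ≠ j → B p m * jordanVec B D r j m = 0 := by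
      intro p m hp hm
      rcases lt_or_gt_of_ne hm with hlt | hgt
      · by_cases hDm : D m
        · rw [h.zero_below m hDm p ((h.strictMono m j hlt hDm).trans_le hp), zero_mul]
        · rw [h.zero_col m hDm, zero_mul]
      · rw [ih.2 m hgt, mul_zero]
    rw [jordanVec_pivot h hj]
    have hsum : ∀ p, r j ≤ p → (B *ᵥ jordanVec B D r j) p = B p j := by
      intro p hp
      rw [Matrix.mulVec, dotProduct, Finset.sum_eq_single j (fun m _ hm => hz p m hp hm) (by simp),
        ih.1, mul_one]
    exact ⟨by rw [hsum _ le_rfl, h.pivot_eq_one j hj],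
      fun m hm => by rw [hsum _ hm.le, h.zero_below j hj m hm]⟩

theorem mulVec_jordanVec_eq_zero (h : IsPivotFun B D r) {j : Fin k} (hj : ¬ D j) :
    B *ᵥ jordanVec B D r j = 0 := by
  ext i
  change ∑ m, B i m * jordanVec B D r j m = 0
  refine Finset.sum_eq_zero fun m _ => ?_
  rcases le_or_gt m j with hle | hgt
  · have hDm : ¬ D m := by
      rcases hle.eq_or_lt with rfl | hlt
      · exact hj
      · exact fun hDm => hj (h.upward m j hlt hDm)
    rw [h.zero_col m hDm, zero_mul]
  · rw [(jordanVec_triangular h j).2 m hgt, mul_zero]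

theorem norm_jordanVec_le (h : IsPivotFun B D r) {b R : ℝ} (hb : ∀ i j, ‖B i j‖ ≤ b)
    (hR : 1 ≤ R) (hbR : k * b ≤ R) (i m : Fin k) :
    ‖jordanVec B D r i m‖ ≤ R ^ (k - 1 - (i : ℕ)) := by
  refine h.induction (p := fun i => ∀ m, ‖jordanVec B D r i m‖ ≤ R ^ (k - 1 - (i : ℕ)))
    (fun i hi m => ?_) (fun j hj ih m => ?_) i m
  · rw [jordanVec_of_not_mem hi]
    refine le_trans ?_ (one_le_pow₀ hR)
    by_cases him : m = i <;> simp [him]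
  · have hlt := h.lt_self j hj
    have hb0 : 0 ≤ b := (norm_nonneg _).trans (hb j j)
    rw [jordanVec_pivot h hj]
    calc ‖(B *ᵥ jordanVec B D r j) m‖
        ≤ ∑ q, ‖B m q * jordanVec B D r j q‖ :=
          norm_sum_le Finset.univ fun q => B m q * jordanVec B D r j q
      _ ≤ ∑ _q : Fin k, b * R ^ (k - 1 - (j : ℕ)) := by
          refine Finset.sum_le_sum fun q _ => ?_
          rw [norm_mul]
          exact mul_le_mul (hb m q) (ih q) (norm_nonneg _) hb0
      _ = k * b * R ^ (k - 1 - (j : ℕ)) := by simp [mul_assoc]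
      _ ≤ R * R ^ (k - 1 - (j : ℕ)) := by gcongr
      _ = R ^ (k - 1 - (j : ℕ) + 1) := by ring
      _ ≤ R ^ (k - 1 - (r j : ℕ)) := pow_le_pow_right₀ hR (by omega)

end jordanVec

open Classical in
/-- A labelling of the indices in which `r` lowers the label by one. -/
noncomputable def orbitLabel {k : ℕ} (D : Fin k → Prop) (r : Fin k → Fin k) (j : Fin k) : ℕ :=
  if D j ∧ r j < j then orbitLabel D r (r j) + 1 else k * j
termination_by (j : ℕ)
decreasing_by omega

section orbitLabel

variable {k : ℕ} {D : Fin k → Prop} {r : Fin k → Fin k}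

theorem orbitLabel_of_mem (hlt : ∀ j, D j → r j < j) {j : Fin k} (hj : D j) :
    orbitLabel D r j = orbitLabel D r (r j) + 1 := by
  rw [orbitLabel, if_pos ⟨hj, hlt j hj⟩]

theorem orbitLabel_of_not_mem {j : Fin k} (hj : ¬ D j) : orbitLabel D r j = k * j := by
  rw [orbitLabel, if_neg fun h => hj h.1]

theorem orbitLabel_mod_le (hlt : ∀ j, D j → r j < j) (j : Fin k) :
    orbitLabel D r j % k ≤ j ∧ (D j → orbitLabel D r j % k ≠ 0) := by
  induction j using WellFoundedLT.induction with
  | _ j ih =>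
    by_cases hj : D j
    · have h1 := (ih _ (hlt j hj)).1
      have h2 : (r j : ℕ) < j := hlt j hj
      have h3 : (orbitLabel D r (r j) + 1) % k = orbitLabel D r (r j) % k + 1 := by
        rw [Nat.add_mod, Nat.mod_eq_of_lt (a := 1) (by omega), Nat.mod_eq_of_lt (by omega)]
      rw [orbitLabel_of_mem hlt hj, h3]
      exact ⟨by omega, fun _ => by omega⟩
    · rw [orbitLabel_of_not_mem hj]
      simp [hj]

theorem orbitLabel_injective (hlt : ∀ j, D j → r j < j)
    (hinj : ∀ i j, D i → D j → r i = r j → i = j) :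
    Function.Injective (orbitLabel D r) := by
  intro i
  induction i using WellFoundedLT.induction with
  | _ i ih =>
    intro j hij
    by_cases hi : D i <;> by_cases hj : D j
    · rw [orbitLabel_of_mem hlt hi, orbitLabel_of_mem hlt hj] at hij
      exact hinj i j hi hj (ih _ (hlt i hi) (by omega))
    · exact absurd (by rw [hij, orbitLabel_of_not_mem hj]; simp)
        ((orbitLabel_mod_le hlt i).2 hi)
    · exact absurd (by rw [← hij, orbitLabel_of_not_mem hi]; simp)
        ((orbitLabel_mod_le hlt j).2 hj)
    · rw [orbitLabel_of_not_mem hi, orbitLabel_of_not_mem hj] at hij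
      exact Fin.ext (Nat.eq_of_mul_eq_mul_left i.pos hij)

/-- The indices can be permuted so that every orbit of `r` is a run of consecutive indices. -/
theorem exists_perm_consecutive (hlt : ∀ j, D j → r j < j)
    (hinj : ∀ i j, D i → D j → r i = r j → i = j) :
    ∃ σ : Equiv.Perm (Fin k), ∀ p q, D (σ q) → r (σ q) = σ p → (q : ℕ) = p + 1 := by
  refine ⟨Tuple.sort (orbitLabel D r), fun p q hD hpq => ?_⟩
  set σ := Tuple.sort (orbitLabel D r)
  have hmono : StrictMono (orbitLabel D r ∘ σ) := (Tuple.monotone_sort _).strictMono_of_injective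
    ((orbitLabel_injective hlt hinj).comp σ.injective)
  have hlab : (orbitLabel D r ∘ σ) q = (orbitLabel D r ∘ σ) p + 1 := by
    simp only [Function.comp_apply]
    rw [orbitLabel_of_mem hlt hD, hpq]
  have hlt' : p < q := hmono.lt_iff_lt.mp (by omega)
  by_contra hne
  have hlt'' : (p : ℕ) < q := hlt'
  have h1 : p < (⟨p + 1, by omega⟩ : Fin k) := Fin.lt_def.mpr (by simp)
  have h2 : (⟨p + 1, by omega⟩ : Fin k) < q := Fin.lt_def.mpr (by simp only; omega)
  have h3 := hmono h1
  have h4 := hmono h2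
  omega

end orbitLabel

theorem norm_adjugate_apply_le {k : ℕ} {S : Matrix (Fin k) (Fin k) ℂ} {K : ℝ} (hK : 1 ≤ K)
    (hS : ∀ i j, ‖S i j‖ ≤ K) (i j : Fin k) : ‖S.adjugate i j‖ ≤ k.factorial * K ^ k := by
  rw [Matrix.adjugate_apply]
  have h := Matrix.det_le (A := S.updateRow j (Pi.single i 1)) (abv := NormedField.toAbsoluteValue ℂ)
    (x := K) (fun a b => ?_)
  · simpa [NormedField.toAbsoluteValue] using h
  · change ‖S.updateRow j (Pi.single i 1) a b‖ ≤ K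
    rw [Matrix.updateRow_apply]
    split_ifs
    · refine le_trans ?_ hK
      by_cases hbi : b = i <;> simp [hbi]
    · exact hS a b

/-- A nilpotent matrix in reduced column echelon form is conjugate to its Jordan form with
polynomial bounds on the entries of the conjugating matrices. -/
theorem IsReducedColEchelon.exists_conj_jordan {k : ℕ} {B : Matrix (Fin k) (Fin k) ℂ}
    (hB : IsReducedColEchelon B) (hnil : IsNilpotent B) {b R : ℝ} (hb : ∀ i j, ‖B i j‖ ≤ b)
    (hR : 1 ≤ R) (hbR : k * b ≤ R) :
    ∃ S T : Matrix (Fin k) (Fin k) ℂ, S * T = 1 ∧ (∀ i j, ‖S i j‖ ≤ R ^ (k - 1)) ∧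
      (∀ i j, ‖T i j‖ ≤ k.factorial * R ^ ((k - 1) * k)) ∧ IsNilpotentJordan (T * B * S) := by
  classical
  obtain ⟨D, r, h⟩ := hB.exists_isPivotFun hnil
  obtain ⟨σ, hσ⟩ := exists_perm_consecutive h.lt_self fun i j hi hj hij => h.injOn hi hj hij
  set S : Matrix (Fin k) (Fin k) ℂ := Matrix.of fun i j => jordanVec B D r j i with hS
  have hdet : S.det = 1 := by
    have htri : S.IsUpperTriangular := fun i j hij => (jordanVec_triangular h j).2 i hij
    rw [Matrix.det_of_isUpperTriangular htri]
    exact Finset.prod_eq_one fun i _ => (jordanVec_triangular h i).1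
  have hST : S * S.adjugate = 1 := by rw [Matrix.mul_adjugate, hdet, one_smul]
  have hTS : S.adjugate * S = 1 := by rw [Matrix.adjugate_mul, hdet, one_smul]
  have hSle : ∀ i j, ‖S i j‖ ≤ R ^ (k - 1) := fun i j =>
    (norm_jordanVec_le h hb hR hbR j i).trans (pow_le_pow_right₀ hR (by omega))
  set P : Matrix (Fin k) (Fin k) ℂ := Matrix.of fun i j => if D j ∧ r j = i then 1 else 0 with hP
  have hBS : B * S = S * P := by
    ext i j
    have hl : (B * S) i j = (B *ᵥ jordanVec B D r j) i := rfl
    rw [hl, Matrix.mul_apply]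
    by_cases hj : D j
    · rw [← jordanVec_pivot h hj]
      simp [hP, hS, hj]
    · rw [mulVec_jordanVec_eq_zero h hj]
      simp [hP, hj]
  refine ⟨S.submatrix id σ, S.adjugate.submatrix σ id, ?_, fun i j => hSle _ _, fun i j => ?_, ?_⟩
  · rw [Matrix.submatrix_mul_equiv, hST, Matrix.submatrix_id_id]
  · rw [pow_mul]
    exact norm_adjugate_apply_le (one_le_pow₀ hR) hSle _ _
  · have hconj : S.adjugate.submatrix σ id * B * S.submatrix id σ = P.submatrix σ σ := by
      have h1 : S.adjugate.submatrix σ id * B = (S.adjugate * B).submatrix σ id := by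
        ext; simp [Matrix.mul_apply]
      have h2 : (S.adjugate * B).submatrix σ id * S.submatrix id σ =
          (S.adjugate * B * S).submatrix σ σ := by
        ext; simp [Matrix.mul_apply]
      rw [h1, h2, Matrix.mul_assoc, hBS, ← Matrix.mul_assoc, hTS, Matrix.one_mul]
    rw [hconj]
    intro p q
    simp only [hP, Matrix.submatrix_apply, Matrix.of_apply]
    refine ⟨fun hpq => if_neg fun hc => hpq (hσ p q hc.1 hc.2), ?_⟩
    split_ifs <;> simp

section opNorm

variable {ι κ : Type*} [Fintype ι] [Fintype κ] [DecidableEq κ]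

theorem norm_apply_le_opNorm (M : Matrix ι κ ℂ) (i : ι) (j : κ) : ‖M i j‖ ≤ opNorm M := by
  have h := (LinearMap.toContinuousLinearMap (Matrix.toEuclideanLin M)).le_opNorm
    (EuclideanSpace.single j 1)
  have h2 := PiLp.norm_apply_le (LinearMap.toContinuousLinearMap (Matrix.toEuclideanLin M)
    (EuclideanSpace.single j (1 : ℂ))) i
  simp only [PiLp.norm_single, norm_one, mul_one] at h
  refine le_trans (le_of_eq ?_) (h2.trans h)
  simp [Matrix.toLpLin_apply, Matrix.mulVec_single]

theorem opNorm_le_of_norm_apply_le {M : Matrix ι κ ℂ} {c : ℝ} (hc : 0 ≤ c)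
    (hM : ∀ i j, ‖M i j‖ ≤ c) : opNorm M ≤ Fintype.card ι * Fintype.card κ * c := by
  refine ContinuousLinearMap.opNorm_le_bound _ (by positivity) fun x => ?_
  set y := LinearMap.toContinuousLinearMap (Matrix.toEuclideanLin M) x
  have hy : ∀ i, ‖y i‖ ≤ Fintype.card κ * (c * ‖x‖) := by
    intro i
    calc ‖y i‖ ≤ ∑ j, ‖M i j * x j‖ := norm_sum_le _ _
      _ ≤ ∑ _j : κ, c * ‖x‖ := by
          refine Finset.sum_le_sum fun j _ => ?_
          rw [norm_mul]
          exact mul_le_mul (hM i j) (PiLp.norm_apply_le x j) (norm_nonneg _) hc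
      _ = Fintype.card κ * (c * ‖x‖) := by simp
  calc ‖y‖ ≤ ∑ i, ‖y i‖ := by
        rw [EuclideanSpace.norm_eq]
        refine Real.sqrt_le_iff.mpr ⟨by positivity, ?_⟩
        exact Finset.sum_sq_le_sq_sum_of_nonneg fun i _ => norm_nonneg _
    _ ≤ ∑ _i : ι, Fintype.card κ * (c * ‖x‖) := Finset.sum_le_sum fun i _ => hy i
    _ = Fintype.card ι * Fintype.card κ * c * ‖x‖ := by simp; ring

end opNorm

section block

variable {l : ℕ} {s : Fin l → ℕ}

theorem isBlockDiag_blockDiagonal' (M : ∀ i, Matrix (Fin (s i)) (Fin (s i)) ℂ) :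
    IsBlockDiag (Matrix.blockDiagonal' M) := by
  rintro ⟨i, p⟩ ⟨j, q⟩ hij
  exact Matrix.blockDiagonal'_apply_ne M p q hij

theorem diagBlock_blockDiagonal' (M : ∀ i, Matrix (Fin (s i)) (Fin (s i)) ℂ) (i : Fin l) :
    diagBlock (Matrix.blockDiagonal' M) i = M i := by
  ext p q
  exact Matrix.blockDiagonal'_apply_eq M i p q

theorem IsBlockDiag.eq_blockDiagonal'
    {A : Matrix ((i : Fin l) × Fin (s i)) ((i : Fin l) × Fin (s i)) ℂ} (hA : IsBlockDiag A) :
    A = Matrix.blockDiagonal' (diagBlock A) := by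
  ext ⟨i, p⟩ ⟨j, q⟩
  by_cases hij : i = j
  · subst hij
    rw [Matrix.blockDiagonal'_apply_eq]
    rfl
  · rw [Matrix.blockDiagonal'_apply_ne _ _ _ hij]
    exact hA _ _ hij

theorem IsBlockDiag.isNilpotent_diagBlock
    {A : Matrix ((i : Fin l) × Fin (s i)) ((i : Fin l) × Fin (s i)) ℂ} (hA : IsBlockDiag A)
    (hnil : IsNilpotent A) (i : Fin l) : IsNilpotent (diagBlock A i) := by
  obtain ⟨e, he⟩ := hnil
  refine ⟨e, ?_⟩
  rw [hA.eq_blockDiagonal', ← Matrix.blockDiagonal'_pow] at he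
  have := diagBlock_blockDiagonal' (diagBlock A ^ e) i
  rw [he] at this
  rw [← Pi.pow_apply, ← this]
  rfl

theorem norm_blockDiagonal'_apply_le {M : ∀ i, Matrix (Fin (s i)) (Fin (s i)) ℂ} {c : ℝ}
    (hc : 0 ≤ c) (hM : ∀ i p q, ‖M i p q‖ ≤ c) (x y : (i : Fin l) × Fin (s i)) :
    ‖Matrix.blockDiagonal' M x y‖ ≤ c := by
  obtain ⟨i, p⟩ := x
  obtain ⟨j, q⟩ := y
  by_cases hij : i = j
  · subst hij
    rw [Matrix.blockDiagonal'_apply_eq]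
    exact hM i p q
  · rw [Matrix.blockDiagonal'_apply_ne _ _ _ hij, norm_zero]
    exact hc

end block

theorem Nat.pred_mul_self_le_factorial (n : ℕ) : (n - 1) * n ≤ n.factorial := by
  rcases n with _ | _ | n
  · simp
  · simp
  · rw [Nat.factorial_succ, Nat.factorial_succ]
    have := Nat.mul_le_mul_left ((n + 1) * (n + 2)) (Nat.factorial_pos n)
    simp only [Nat.add_sub_cancel]
    nlinarith

/-- A nonzero block diagonal nilpotent matrix with blocks in reduced column
echelon form can be conjugated to Jordan normal form by a block diagonal `S` with
`‖S^{±1}‖ ≤ C(n)(1+‖A‖)^{n!}`. -/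
theorem reduced_echelon_to_jordan (n : ℕ) :
    ∃ C > 0, ∀ (l : ℕ) (s : Fin l → ℕ)
      (hn : Fintype.card ((i : Fin l) × Fin (s i)) = n)
      (A : Matrix ((i : Fin l) × Fin (s i)) ((i : Fin l) × Fin (s i)) ℂ),
      A ≠ 0 → IsNilpotent A → IsBlockDiag A →
      (∀ i, IsReducedColEchelon (diagBlock A i)) →
      ∃ S : Matrix ((i : Fin l) × Fin (s i)) ((i : Fin l) × Fin (s i)) ℂ,
        IsBlockDiag S ∧ IsUnit S ∧
        opNorm S ≤ C * (1 + opNorm A) ^ (Nat.factorial n) ∧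
        opNorm S⁻¹ ≤ C * (1 + opNorm A) ^ (Nat.factorial n) ∧
        IsBlockDiag (S⁻¹ * A * S) ∧
        ∀ i, IsNilpotentJordan (diagBlock (S⁻¹ * A * S) i) := by
  refine ⟨n * n * (n.factorial * n ^ ((n - 1) * n)) + 1, by positivity, ?_⟩
  intro l s hn A hA0 hnil hA hech
  have hne : Nonempty ((i : Fin l) × Fin (s i)) := by
    by_contra hemp
    exact hA0 (Matrix.ext fun x => absurd ⟨x⟩ hemp)
  have hn1 : 1 ≤ n := hn ▸ Fintype.card_pos
  have hn1' : (1 : ℝ) ≤ n := by exact_mod_cast hn1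
  have ha : 0 ≤ opNorm A := norm_nonneg _
  have hs : ∀ i, s i ≤ n := by
    intro i
    rw [← hn, Fintype.card_sigma]
    simpa using Finset.single_le_sum (f := s) (fun _ _ => Nat.zero_le _) (Finset.mem_univ i)
  set R : ℝ := n * (1 + opNorm A) with hRdef
  have hR : 1 ≤ R := by nlinarith
  have hbR : ∀ i, s i * opNorm A ≤ R := by
    intro i
    have : (s i : ℝ) ≤ n := by exact_mod_cast hs i
    nlinarith
  choose S T hST hSle hTle hJ using fun i => (hech i).exists_conj_jordan
    (hA.isNilpotent_diagBlock hnil i) (fun p q => norm_apply_le_opNorm A ⟨i, p⟩ ⟨i, q⟩) hR (hbR i)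
  set c : ℝ := n.factorial * R ^ ((n - 1) * n) with hc
  have hc0 : 0 ≤ c := by positivity
  have hfac : (1 : ℝ) ≤ n.factorial := by exact_mod_cast Nat.factorial_pos n
  have hSc : ∀ i p q, ‖S i p q‖ ≤ c := by
    intro i p q
    have hexp : s i - 1 ≤ (n - 1) * n :=
      (Nat.sub_le_sub_right (hs i) 1).trans (Nat.le_mul_of_pos_right _ hn1)
    calc ‖S i p q‖ ≤ R ^ (s i - 1) := hSle i p q
      _ ≤ R ^ ((n - 1) * n) := pow_le_pow_right₀ hR hexp
      _ ≤ c := le_mul_of_one_le_left (by positivity) hfac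
  have hTc : ∀ i p q, ‖T i p q‖ ≤ c := by
    intro i p q
    refine (hTle i p q).trans (mul_le_mul ?_ ?_ (by positivity) (by positivity))
    · exact_mod_cast Nat.factorial_le (hs i)
    · exact pow_le_pow_right₀ hR (Nat.mul_le_mul (Nat.sub_le_sub_right (hs i) 1) (hs i))
  have hbound : ∀ M : ∀ i, Matrix (Fin (s i)) (Fin (s i)) ℂ, (∀ i p q, ‖M i p q‖ ≤ c) →
      opNorm (Matrix.blockDiagonal' M) ≤
        (n * n * (n.factorial * n ^ ((n - 1) * n)) + 1) * (1 + opNorm A) ^ n.factorial := by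
    intro M hM
    refine (opNorm_le_of_norm_apply_le hc0 (norm_blockDiagonal'_apply_le hc0 hM)).trans ?_
    rw [hn, hc, hRdef, mul_pow]
    have hpow : (1 + opNorm A) ^ ((n - 1) * n) ≤ (1 + opNorm A) ^ n.factorial :=
      pow_le_pow_right₀ (by linarith) n.pred_mul_self_le_factorial
    calc (n * n * (n.factorial * (n ^ ((n - 1) * n) * (1 + opNorm A) ^ ((n - 1) * n))) : ℝ)
        = n * n * (n.factorial * n ^ ((n - 1) * n)) * (1 + opNorm A) ^ ((n - 1) * n) := by ring
      _ ≤ _ := mul_le_mul (by linarith) hpow (by positivity) (by positivity)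
  have hmul : Matrix.blockDiagonal' S * Matrix.blockDiagonal' T = 1 := by
    rw [← Matrix.blockDiagonal'_mul]
    simp only [hST]
    exact Matrix.blockDiagonal'_one
  have hinv : (Matrix.blockDiagonal' S)⁻¹ = Matrix.blockDiagonal' T := Matrix.inv_eq_right_inv hmul
  have hconj : (Matrix.blockDiagonal' S)⁻¹ * A * Matrix.blockDiagonal' S =
      Matrix.blockDiagonal' fun i => T i * diagBlock A i * S i := by
    conv_lhs => rw [hinv, hA.eq_blockDiagonal']
    rw [← Matrix.blockDiagonal'_mul, ← Matrix.blockDiagonal'_mul]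
  refine ⟨Matrix.blockDiagonal' S, isBlockDiag_blockDiagonal' S, .of_mul_eq_one _ hmul,
    hbound S hSc, hinv ▸ hbound T hTc, ?_, fun i => ?_⟩
  · rw [hconj]
    exact isBlockDiag_blockDiagonal' _
  · rw [hconj, diagBlock_blockDiagonal']
    exact hJ i
end
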